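/- Let $K$ be a field and $n$ a positive integer such that either ($n\geq 4$ and $\mathrm{char}\,K\neq 3$) or $n\geq 5$. Then for every integer $s\geq 2$, the Chein automorphism $C(y_1^s)=(x_1+[x_2,x_3]y_1^s,\ x_2,\ldots,x_n)$ of $M_n$ is tame. -/

import Mathlib

noncomputable section

/-- The free metabelian Lie algebra of rank `n` over `K`: the quotient of the free Lie
algebra on `n` generators by its second derived ideal. -/
abbrev FreeMetabelianLie (K : Type) [Field K] (n : ℕ) : Type :=
  FreeLieAlgebra K (Fin n) ⧸ LieAlgebra.derivedSeries K (FreeLieAlgebra K (Fin n)) 2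

/-- The free generators `x₁, …, xₙ` of the free metabelian Lie algebra. -/
def xg (K : Type) [Field K] (n : ℕ) (i : Fin n) : FreeMetabelianLie K n :=
  LieSubmodule.Quotient.mk (N := LieAlgebra.derivedSeries K (FreeLieAlgebra K (Fin n)) 2)
    (FreeLieAlgebra.of K i)

/-- The group structure on Lie algebra automorphisms, with `(e * f) x = e (f x)`. -/
instance lieAutGroup (K : Type) [CommRing K] (L : Type) [LieRing L] [LieAlgebra K L] :
    Group (L ≃ₗ⁅K⁆ L) where
  mul e f := f.trans e
  one := LieEquiv.refl
  inv := LieEquiv.symm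
  mul_assoc _ _ _ := LieEquiv.ext fun _ => rfl
  one_mul _ := LieEquiv.ext fun _ => rfl
  mul_one _ := LieEquiv.ext fun _ => rfl
  inv_mul_cancel e := LieEquiv.ext fun x => e.symm_apply_apply x

/-- An automorphism of the free metabelian Lie algebra is elementary if it maps some `xᵢ` to
`α • xᵢ + f`, with `0 ≠ α ∈ K` and `f` in the subalgebra generated by the other generators,
and fixes all other generators. -/
def IsElementaryAut (K : Type) [Field K] (n : ℕ)
    (φ : FreeMetabelianLie K n ≃ₗ⁅K⁆ FreeMetabelianLie K n) : Prop :=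
  ∃ (i : Fin n) (α : K) (f : FreeMetabelianLie K n), α ≠ 0 ∧
    f ∈ LieSubalgebra.lieSpan K (FreeMetabelianLie K n) (xg K n '' {j | j ≠ i}) ∧
    φ (xg K n i) = α • xg K n i + f ∧ ∀ j : Fin n, j ≠ i → φ (xg K n j) = xg K n j

/-- A tame automorphism is one in the subgroup generated by the elementary automorphisms. -/
def IsTame (K : Type) [Field K] (n : ℕ)
    (φ : FreeMetabelianLie K n ≃ₗ⁅K⁆ FreeMetabelianLie K n) : Prop :=
  φ ∈ Subgroup.closure {ψ | IsElementaryAut K n ψ}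

/-- A Chein automorphism (one-row transformation) moves only one generator. -/
def IsCheinAut (K : Type) [Field K] (n : ℕ)
    (φ : FreeMetabelianLie K n ≃ₗ⁅K⁆ FreeMetabelianLie K n) : Prop :=
  ∃ i : Fin n, ∀ j : Fin n, j ≠ i → φ (xg K n j) = xg K n j

/-- An almost tame automorphism is one in the subgroup generated by Chein automorphisms. -/
def IsAlmostTame (K : Type) [Field K] (n : ℕ)
    (φ : FreeMetabelianLie K n ≃ₗ⁅K⁆ FreeMetabelianLie K n) : Prop :=
  φ ∈ Subgroup.closure {ψ | IsCheinAut K n ψ}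

/-- `monoSet K n k` is the set of right-normed Lie monomials of degree `k+1` in the
generators. -/
def monoSet (K : Type) [Field K] (n : ℕ) : ℕ → Set (FreeMetabelianLie K n)
  | 0 => Set.range (xg K n)
  | k + 1 => {z | ∃ u ∈ monoSet K n k, ∃ i : Fin n, z = ⁅u, xg K n i⁆}

/-- `gradePiece K n k` (for `k ≥ 1`) is the homogeneous component `L_k` of the standard
grading: the linear span of the Lie monomials of degree `k` in the generators. -/
def gradePiece (K : Type) [Field K] (n : ℕ) (k : ℕ) : Submodule K (FreeMetabelianLie K n) :=
  Submodule.span K (monoSet K n (k - 1))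

/-- The automorphism `φ = (l₁ + m₁, …, lₙ + mₙ)` (with `lᵢ` linear, `mᵢ ∈ [M,M]`) has lower
degree `≥ d`: each `φ(xᵢ)` lies in `L₁ ⊕ (⨆ k ≥ d, L_k)`. -/
def AutLdegGE (K : Type) [Field K] (n : ℕ)
    (φ : FreeMetabelianLie K n ≃ₗ⁅K⁆ FreeMetabelianLie K n) (d : ℕ) : Prop :=
  ∀ i : Fin n, φ (xg K n i) ∈
    gradePiece K n 1 ⊔ ⨆ (k : ℕ) (_ : d ≤ k), gradePiece K n k

/-- The action of a polynomial `a ∈ U = K[y₁,…,yₙ]` on `m`; for `m ∈ [M,M]` this is the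
canonical `U`-module action on the derived ideal, determined by `m ⬝ yᵢ = ⁅m, xᵢ⁆`. -/
def polyAct (K : Type) [Field K] (n : ℕ) (a : MvPolynomial (Fin n) K)
    (m : FreeMetabelianLie K n) : FreeMetabelianLie K n :=
  ∑ d ∈ a.support, a.coeff d •
    ((List.ofFn fun i : Fin n =>
      (-(LieAlgebra.ad K (FreeMetabelianLie K n) (xg K n i))) ^ (d i)).prod m)

/-- The polynomial `a` has lower degree `≥ d`: every monomial of `a` has total degree `≥ d`. -/
def PolyLdegGE (K : Type) [Field K] (n : ℕ) (a : MvPolynomial (Fin n) K) (d : ℕ) : Prop :=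
  ∀ v ∈ a.support, d ≤ ∑ i, v i

/-- An exponential automorphism: `exp (ad z) = id + ad z` for some `z ∈ [M,M]`. -/
def IsExponentialAut (K : Type) [Field K] (n : ℕ)
    (φ : FreeMetabelianLie K n ≃ₗ⁅K⁆ FreeMetabelianLie K n) : Prop :=
  ∃ z ∈ LieAlgebra.derivedSeries K (FreeMetabelianLie K n) 1,
    ∀ m : FreeMetabelianLie K n, φ m = m + ⁅z, m⁆

end

noncomputable section

namespace FreeMetabelianLie

variable {K : Type} [Field K] {n : ℕ}

/-- The quotient map from the free Lie algebra, as a morphism of Lie algebras. -/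
def mkHom (K : Type) [Field K] (n : ℕ) :
    FreeLieAlgebra K (Fin n) →ₗ⁅K⁆ FreeMetabelianLie K n where
  toLinearMap := (LieAlgebra.derivedSeries K (FreeLieAlgebra K (Fin n)) 2).toSubmodule.mkQ
  map_lie' := rfl

theorem mkHom_surjective : Function.Surjective (mkHom K n) := Submodule.mkQ_surjective _

theorem mkHom_eq_zero {a : FreeLieAlgebra K (Fin n)}
    (ha : a ∈ LieAlgebra.derivedSeries K (FreeLieAlgebra K (Fin n)) 2) : mkHom K n a = 0 :=
  LieSubmodule.Quotient.mk_eq_zero'.2 ha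

variable (K n) in
theorem derivedSeries_two_eq_bot :
    LieAlgebra.derivedSeries K (FreeMetabelianLie K n) 2 = ⊥ := by
  rw [← LieIdeal.derivedSeries_map_eq 2 (mkHom_surjective (K := K) (n := n)),
    eq_bot_iff, LieIdeal.map_le]
  rintro _ ⟨a, ha, rfl⟩
  exact mkHom_eq_zero ha

/-- Morphisms out of the free metabelian Lie algebra are determined on generators. -/
theorem hom_ext {L : Type} [LieRing L] [LieAlgebra K L] {α β : FreeMetabelianLie K n →ₗ⁅K⁆ L}
    (h : ∀ j, α (xg K n j) = β (xg K n j)) : α = β := by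
  have h' : α.comp (mkHom K n) = β.comp (mkHom K n) :=
    FreeLieAlgebra.hom_ext fun j => h j
  ext x
  obtain ⟨a, rfl⟩ := mkHom_surjective x
  exact LieHom.congr_fun h' a

/-- The endomorphism of the free metabelian Lie algebra with prescribed images of generators. -/
def liftEnd (f : Fin n → FreeMetabelianLie K n) :
    FreeMetabelianLie K n →ₗ⁅K⁆ FreeMetabelianLie K n where
  toLinearMap := Submodule.liftQ _ (FreeLieAlgebra.lift K f : _ →ₗ[K] FreeMetabelianLie K n) (by
    intro a ha
    have h := LieIdeal.derivedSeries_map_le (f := FreeLieAlgebra.lift K f) 2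
      (LieIdeal.mem_map (f := FreeLieAlgebra.lift K f) ha)
    rwa [derivedSeries_two_eq_bot, LieSubmodule.mem_bot] at h)
  map_lie' := by
    intro x y
    obtain ⟨a, rfl⟩ := mkHom_surjective x
    obtain ⟨b, rfl⟩ := mkHom_surjective y
    exact (FreeLieAlgebra.lift K f).map_lie a b

@[simp]
theorem liftEnd_xg (f : Fin n → FreeMetabelianLie K n) (i : Fin n) :
    liftEnd f (xg K n i) = f i :=
  FreeLieAlgebra.lift_of_apply f i

/-- The derived ideal of the free metabelian Lie algebra. -/
abbrev derived (K : Type) [Field K] (n : ℕ) : LieIdeal K (FreeMetabelianLie K n) :=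
  LieAlgebra.derivedSeries K (FreeMetabelianLie K n) 1

theorem lie_mem_derived (x y : FreeMetabelianLie K n) : ⁅x, y⁆ ∈ derived K n :=
  LieSubmodule.lie_mem_lie (LieSubmodule.mem_top x) (LieSubmodule.mem_top y)

theorem lie_eq_zero {x y : FreeMetabelianLie K n} (hx : x ∈ derived K n)
    (hy : y ∈ derived K n) : ⁅x, y⁆ = 0 := by
  have h : ⁅x, y⁆ ∈ LieAlgebra.derivedSeries K (FreeMetabelianLie K n) 2 :=
    LieSubmodule.lie_mem_lie hx hy
  rwa [derivedSeries_two_eq_bot, LieSubmodule.mem_bot] at h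

theorem map_mem_derived (α : FreeMetabelianLie K n →ₗ⁅K⁆ FreeMetabelianLie K n)
    {d : FreeMetabelianLie K n} (hd : d ∈ derived K n) : α d ∈ derived K n :=
  LieIdeal.derivedSeries_map_le (f := α) 1 (LieIdeal.mem_map (f := α) hd)

theorem lie_lie_comm {d : FreeMetabelianLie K n} (hd : d ∈ derived K n)
    (x y : FreeMetabelianLie K n) : ⁅⁅d, x⁆, y⁆ = ⁅⁅d, y⁆, x⁆ := by
  have h : ⁅d, ⁅x, y⁆⁆ = 0 := lie_eq_zero hd (lie_mem_derived x y)
  rw [leibniz_lie, ← lie_skew x, ← sub_eq_add_neg, sub_eq_zero] at h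
  exact h

/-- An endomorphism moving at most the generator `xᵢ`, by adding `f` to it. -/
structure IsShift (i : Fin n) (f : FreeMetabelianLie K n)
    (α : FreeMetabelianLie K n →ₗ⁅K⁆ FreeMetabelianLie K n) : Prop where
  apply_self : α (xg K n i) = xg K n i + f
  apply_of_ne : ∀ j, j ≠ i → α (xg K n j) = xg K n j

/-- The subalgebra generated by the generators other than `xᵢ`. -/
abbrev others (K : Type) [Field K] (n : ℕ) (i : Fin n) :
    LieSubalgebra K (FreeMetabelianLie K n) :=
  LieSubalgebra.lieSpan K (FreeMetabelianLie K n) (xg K n '' {j | j ≠ i})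

theorem xg_mem_others {i j : Fin n} (h : j ≠ i) : xg K n j ∈ others K n i :=
  LieSubalgebra.subset_lieSpan ⟨j, h, rfl⟩

theorem IsShift.apply_of_mem {i : Fin n} {f x : FreeMetabelianLie K n}
    {α : FreeMetabelianLie K n →ₗ⁅K⁆ FreeMetabelianLie K n}
    (hα : IsShift i f α) (hx : x ∈ others K n i) : α x = x := by
  induction hx using LieSubalgebra.lieSpan_induction with
  | mem x hx =>
    obtain ⟨j, hj, rfl⟩ := hx
    exact hα.apply_of_ne j hj
  | zero => exact map_zero α
  | add x y _ _ hx hy => rw [map_add, hx, hy]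
  | smul c x _ hx => rw [map_smul, hx]
  | lie x y _ _ hx hy => rw [LieHom.map_lie, hx, hy]

/-- The shift of `xᵢ` by `f`, as an endomorphism. -/
def shiftEnd (i : Fin n) (f : FreeMetabelianLie K n) :
    FreeMetabelianLie K n →ₗ⁅K⁆ FreeMetabelianLie K n :=
  liftEnd (Function.update (xg K n) i (xg K n i + f))

theorem isShift_shiftEnd (i : Fin n) (f : FreeMetabelianLie K n) :
    IsShift i f (shiftEnd i f) where
  apply_self := by simp [shiftEnd]
  apply_of_ne j hj := by simp [shiftEnd, hj]

theorem exists_isShift_equiv {i : Fin n} {f : FreeMetabelianLie K n}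
    (h₁ : shiftEnd i f f = f) (h₂ : shiftEnd i (-f) f = f) :
    ∃ φ : FreeMetabelianLie K n ≃ₗ⁅K⁆ FreeMetabelianLie K n,
      IsShift i f (φ : FreeMetabelianLie K n →ₗ⁅K⁆ FreeMetabelianLie K n) := by
  have key : ∀ g : FreeMetabelianLie K n, shiftEnd i (-g) g = g →
      (shiftEnd i (-g)).comp (shiftEnd i g) = (1 : _ →ₗ⁅K⁆ _) := by
    intro g hg
    refine hom_ext fun j => ?_
    by_cases hj : j = i
    · simp [hj, (isShift_shiftEnd i g).apply_self, (isShift_shiftEnd i (-g)).apply_self, hg]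
    · simp [(isShift_shiftEnd i g).apply_of_ne j hj, (isShift_shiftEnd i (-g)).apply_of_ne j hj]
  have k₁ := key f h₂
  have k₂ := key (-f) (by rw [neg_neg, map_neg, h₁])
  rw [neg_neg] at k₂
  exact ⟨{ shiftEnd i f with
      invFun := shiftEnd i (-f)
      left_inv := fun x => LieHom.congr_fun k₁ x
      right_inv := fun x => LieHom.congr_fun k₂ x }, isShift_shiftEnd i f⟩

/-- Elements of the derived ideal fixed by every shift of `xᵢ` by an element of the derived
ideal. -/
def fixedSub (K : Type) [Field K] (n : ℕ) (i : Fin n) : Submodule K (FreeMetabelianLie K n) where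
  carrier := {f | f ∈ derived K n ∧ ∀ α : FreeMetabelianLie K n →ₗ⁅K⁆ FreeMetabelianLie K n,
    ∀ d ∈ derived K n, IsShift i d α → α f = f}
  add_mem' := fun ⟨h₁, h₂⟩ ⟨h₃, h₄⟩ => ⟨add_mem h₁ h₃, fun α d hd hα => by
    rw [map_add, h₂ α d hd hα, h₄ α d hd hα]⟩
  zero_mem' := ⟨zero_mem _, fun α _ _ _ => map_zero α⟩
  smul_mem' := fun c _ ⟨h₁, h₂⟩ => ⟨(derived K n).smul_mem c h₁, fun α d hd hα => by
    rw [map_smul, h₂ α d hd hα]⟩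

theorem mem_fixedSub_of_mem_others {i : Fin n} {f : FreeMetabelianLie K n}
    (hd : f ∈ derived K n) (hf : f ∈ others K n i) : f ∈ fixedSub K n i :=
  ⟨hd, fun _ _ _ hα => hα.apply_of_mem hf⟩

theorem lie_xg_mem_fixedSub {i : Fin n} {f : FreeMetabelianLie K n} (hf : f ∈ fixedSub K n i)
    (j : Fin n) : ⁅f, xg K n j⁆ ∈ fixedSub K n i := by
  refine ⟨lie_mem_derived _ _, fun α d hd hα => ?_⟩
  rw [LieHom.map_lie, hf.2 α d hd hα]
  by_cases hj : j = i
  · rw [hj, hα.apply_self, lie_add, lie_eq_zero hf.1 hd, add_zero]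
  · rw [hα.apply_of_ne j hj]

theorem exists_isShift_of_mem_fixedSub {i : Fin n} {f : FreeMetabelianLie K n}
    (hf : f ∈ fixedSub K n i) :
    ∃ φ : FreeMetabelianLie K n ≃ₗ⁅K⁆ FreeMetabelianLie K n,
      IsShift i f (φ : FreeMetabelianLie K n →ₗ⁅K⁆ FreeMetabelianLie K n) :=
  exists_isShift_equiv (hf.2 _ f hf.1 (isShift_shiftEnd i f))
    (hf.2 _ (-f) (neg_mem hf.1) (isShift_shiftEnd i (-f)))

theorem equiv_ext {φ ψ : FreeMetabelianLie K n ≃ₗ⁅K⁆ FreeMetabelianLie K n}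
    (h : ∀ j, φ (xg K n j) = ψ (xg K n j)) : φ = ψ := by
  have h' : (φ : FreeMetabelianLie K n →ₗ⁅K⁆ FreeMetabelianLie K n) = ψ := hom_ext h
  exact LieEquiv.ext fun x => LieHom.congr_fun h' x

theorem mul_apply (φ ψ : FreeMetabelianLie K n ≃ₗ⁅K⁆ FreeMetabelianLie K n)
    (x : FreeMetabelianLie K n) : (φ * ψ) x = φ (ψ x) := rfl

theorem _root_.IsTame.mul {φ ψ : FreeMetabelianLie K n ≃ₗ⁅K⁆ FreeMetabelianLie K n}
    (hφ : IsTame K n φ) (hψ : IsTame K n ψ) : IsTame K n (φ * ψ) := mul_mem hφ hψ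

theorem _root_.IsTame.inv {φ : FreeMetabelianLie K n ≃ₗ⁅K⁆ FreeMetabelianLie K n}
    (hφ : IsTame K n φ) : IsTame K n φ⁻¹ := inv_mem hφ

/-- An automorphism moving at most the generator `xᵢ`, by adding `f` to it. -/
abbrev IsShiftAut (i : Fin n) (f : FreeMetabelianLie K n)
    (φ : FreeMetabelianLie K n ≃ₗ⁅K⁆ FreeMetabelianLie K n) : Prop :=
  IsShift i f (φ : FreeMetabelianLie K n →ₗ⁅K⁆ FreeMetabelianLie K n)

namespace IsShiftAut

variable {i : Fin n} {f : FreeMetabelianLie K n}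
  {φ : FreeMetabelianLie K n ≃ₗ⁅K⁆ FreeMetabelianLie K n}

theorem self (h : IsShiftAut i f φ) : φ (xg K n i) = xg K n i + f := h.apply_self

theorem ne (h : IsShiftAut i f φ) {j : Fin n} (hj : j ≠ i) : φ (xg K n j) = xg K n j :=
  h.apply_of_ne j hj

theorem fixed (h : IsShiftAut i f φ) {g : FreeMetabelianLie K n} (hf : f ∈ derived K n)
    (hg : g ∈ fixedSub K n i) : φ g = g := hg.2 _ f hf h

theorem fixed_of_mem (h : IsShiftAut i f φ) {g : FreeMetabelianLie K n}
    (hg : g ∈ others K n i) : φ g = g := h.apply_of_mem hg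

theorem isTame (h : IsShiftAut i f φ) (hf : f ∈ others K n i) : IsTame K n φ :=
  Subgroup.subset_closure ⟨i, 1, f, one_ne_zero, hf, by rw [one_smul, h.self],
    fun _ hj => h.ne hj⟩

end IsShiftAut

/-- The elements `f` of `fixedSub K n i` such that adding any multiple of `f` to `xᵢ` gives a tame
automorphism. -/
def tameSub (K : Type) [Field K] (n : ℕ) (i : Fin n) : Submodule K (FreeMetabelianLie K n) where
  carrier := {f | f ∈ fixedSub K n i ∧ ∀ (c : K) φ, IsShiftAut i (c • f) φ → IsTame K n φ}
  add_mem' := by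
    rintro f g ⟨hf, hf'⟩ ⟨hg, hg'⟩
    refine ⟨add_mem hf hg, fun c φ hφ => ?_⟩
    have hcf := (fixedSub K n i).smul_mem c hf
    have hcg := (fixedSub K n i).smul_mem c hg
    obtain ⟨ψ, hψ⟩ := exists_isShift_of_mem_fixedSub hcf
    obtain ⟨χ, hχ⟩ := exists_isShift_of_mem_fixedSub hcg
    have : φ = ψ * χ := equiv_ext fun j => by
      rw [mul_apply]
      by_cases hj : j = i
      · rw [hj, IsShiftAut.self hφ, IsShiftAut.self hχ, map_add, IsShiftAut.self hψ,
          IsShiftAut.fixed hψ hcf.1 hcg, smul_add, add_assoc]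
      · rw [IsShiftAut.ne hφ hj, IsShiftAut.ne hχ hj, IsShiftAut.ne hψ hj]
    exact this ▸ (hf' c ψ hψ).mul (hg' c χ hχ)
  zero_mem' := ⟨zero_mem _, fun c φ hφ => IsShiftAut.isTame hφ (by simp)⟩
  smul_mem' := by
    rintro a f ⟨hf, hf'⟩
    exact ⟨(fixedSub K n i).smul_mem a hf, fun c φ hφ => hf' (c * a) φ (by rwa [mul_smul])⟩

theorem mem_tameSub_of_mem_others {i : Fin n} {f : FreeMetabelianLie K n}
    (hd : f ∈ derived K n) (hf : f ∈ others K n i) : f ∈ tameSub K n i :=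
  ⟨mem_fixedSub_of_mem_others hd hf, fun c _ hφ =>
    IsShiftAut.isTame hφ ((others K n i).smul_mem c hf)⟩

/-- The commutator of tame shifts of two different generators. -/
theorem mem_tameSub_of_commutator {i l : Fin n} {f g h : FreeMetabelianLie K n} (hil : i ≠ l)
    (hf : f ∈ tameSub K n i) (hg : g ∈ tameSub K n l) (hgi : g ∈ fixedSub K n i)
    (hh : h ∈ fixedSub K n i)
    (H : ∀ (c : K) β, IsShiftAut l (c • g) β → β f = f + c • h) : h ∈ tameSub K n i := by
  refine ⟨hh, fun c φ hφ => ?_⟩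
  have hcg := (fixedSub K n l).smul_mem c hg.1
  have hch := (fixedSub K n i).smul_mem c hh
  obtain ⟨α, hα⟩ := exists_isShift_of_mem_fixedSub hf.1
  obtain ⟨β, hβ⟩ := exists_isShift_of_mem_fixedSub hcg
  have key : φ * (α * β) = β * α := equiv_ext fun j => by
    simp only [mul_apply]
    by_cases hj : j = i
    · rw [hj, IsShiftAut.ne hβ hil, IsShiftAut.self hα, map_add, map_add, IsShiftAut.self hφ,
        IsShiftAut.fixed hφ hch.1 hf.1, IsShiftAut.ne hβ hil, H c β hβ]
      abel
    · by_cases hl : j = l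
      · have h₁ := IsShiftAut.fixed hα hf.1.1 ((fixedSub K n i).smul_mem c hgi)
        have h₂ := IsShiftAut.fixed hφ hch.1 ((fixedSub K n i).smul_mem c hgi)
        rw [IsShiftAut.ne hα hj, hl, IsShiftAut.self hβ, map_add, map_add, h₁, h₂,
          IsShiftAut.ne hα hil.symm, IsShiftAut.ne hφ hil.symm]
      · rw [IsShiftAut.ne hβ hl, IsShiftAut.ne hα hj, IsShiftAut.ne hφ hj, IsShiftAut.ne hβ hl]
  rw [eq_mul_inv_of_mul_eq key]
  have tα : IsTame K n α := hf.2 1 α (by rwa [one_smul])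
  have tβ : IsTame K n β := hg.2 c β hβ
  exact (tβ.mul tα).mul (tα.mul tβ).inv

theorem exists_transvection {p r : Fin n} (hpr : r ≠ p) (a : K) :
    ∃ τ, IsShiftAut p (a • xg K n r) τ ∧ IsTame K n τ := by
  have hm : ∀ a : K, a • xg K n r ∈ others K n p := fun a =>
    (others K n p).smul_mem a (xg_mem_others hpr)
  obtain ⟨τ, hτ⟩ := exists_isShift_equiv (i := p) (f := a • xg K n r)
    ((isShift_shiftEnd _ _).apply_of_mem (hm a)) ((isShift_shiftEnd _ _).apply_of_mem (hm a))
  exact ⟨τ, hτ, IsShiftAut.isTame hτ (hm a)⟩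

/-- Conjugation of a tame shift of `xᵢ` by a transvection not involving `xᵢ`. -/
theorem transvection_mem_tameSub {i p r : Fin n} (hp : i ≠ p) (hr : r ≠ i) {a : K}
    {τ : FreeMetabelianLie K n ≃ₗ⁅K⁆ FreeMetabelianLie K n}
    (hτ : IsShiftAut p (a • xg K n r) τ) (tτ : IsTame K n τ)
    {f : FreeMetabelianLie K n} (hf : f ∈ tameSub K n i) : τ f ∈ tameSub K n i := by
  have hi : τ.symm (xg K n i) = xg K n i := by
    rw [LieEquiv.symm_apply_eq, IsShiftAut.ne hτ hp]
  have ho : ∀ j, j ≠ i → τ (xg K n j) ∈ others K n i := fun j hj => by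
    by_cases hjp : j = p
    · subst hjp
      rw [IsShiftAut.self hτ]
      exact add_mem (xg_mem_others hj) ((others K n i).smul_mem a (xg_mem_others hr))
    · rw [IsShiftAut.ne hτ hjp]
      exact xg_mem_others hj
  refine ⟨⟨map_mem_derived (τ : _ →ₗ⁅K⁆ FreeMetabelianLie K n) hf.1.1, fun α d hd hα => ?_⟩,
    fun c φ hφ => ?_⟩
  · have hd' := map_mem_derived (τ.symm : _ →ₗ⁅K⁆ FreeMetabelianLie K n) hd
    have h := hf.1.2 ((τ.symm : _ →ₗ⁅K⁆ FreeMetabelianLie K n).comp (α.comp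
      (τ : _ →ₗ⁅K⁆ FreeMetabelianLie K n))) _ hd' ⟨by
        change τ.symm (α (τ (xg K n i))) = xg K n i + τ.symm d
        rw [IsShiftAut.ne hτ hp, hα.apply_self, map_add, hi], fun j hj => by
        change τ.symm (α (τ (xg K n j))) = xg K n j
        rw [hα.apply_of_mem (ho j hj), LieEquiv.symm_apply_apply]⟩
    change τ.symm (α (τ f)) = f at h
    rwa [LieEquiv.symm_apply_eq] at h
  · have h : IsTame K n (τ⁻¹ * φ * τ) := hf.2 c _ ⟨by
        change τ.symm (φ (τ (xg K n i))) = xg K n i + c • f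
        rw [IsShiftAut.ne hτ hp, IsShiftAut.self hφ, map_add, hi, map_smul,
          LieEquiv.symm_apply_apply], fun j hj => by
        change τ.symm (φ (τ (xg K n j))) = xg K n j
        rw [IsShiftAut.fixed_of_mem hφ (ho j hj), LieEquiv.symm_apply_apply]⟩
    have e : φ = τ * (τ⁻¹ * φ * τ) * τ⁻¹ := by group
    rw [e]
    exact (tτ.mul h).mul tτ.inv

theorem transvection_mem_tameSub_of_mem {i c : Fin n} (hic : i ≠ c)
    {τ : FreeMetabelianLie K n ≃ₗ⁅K⁆ FreeMetabelianLie K n}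
    (hτ : IsShiftAut c ((-1 : K) • xg K n i) τ) (tτ : IsTame K n τ)
    {f : FreeMetabelianLie K n} (hf : f ∈ tameSub K n i) (hc : τ f ∈ tameSub K n c)
    (hi : τ f ∈ fixedSub K n i) : τ f ∈ tameSub K n i := by
  refine ⟨hi, fun e φ hφ => ?_⟩
  have hef := (fixedSub K n i).smul_mem e hf.1
  have hec := (fixedSub K n c).smul_mem e hc.1
  obtain ⟨θ, hθ⟩ := exists_isShift_of_mem_fixedSub hef
  obtain ⟨χ, hχ⟩ := exists_isShift_of_mem_fixedSub hec
  have key : χ * φ * τ = τ * θ := equiv_ext fun j => by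
    simp only [mul_apply]
    have hχF := IsShiftAut.fixed hχ hec.1 hec
    by_cases hj : j = i
    · rw [hj, IsShiftAut.ne hτ hic, IsShiftAut.self hφ, IsShiftAut.self hθ, map_add, map_add,
        IsShiftAut.ne hτ hic, IsShiftAut.ne hχ hic, hχF, map_smul]
    · rw [IsShiftAut.ne hθ hj]
      by_cases hl : j = c
      · rw [hl, IsShiftAut.self hτ, map_add, map_add, map_smul, map_smul, IsShiftAut.self hφ,
          IsShiftAut.ne hφ hic.symm, map_add, IsShiftAut.self hχ, IsShiftAut.ne hχ hic, hχF]
        module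
      · rw [IsShiftAut.ne hτ hl, IsShiftAut.ne hφ hj, IsShiftAut.ne hχ hl]
  have e₁ : φ = χ⁻¹ * (χ * φ * τ) * τ⁻¹ := by group
  rw [e₁, key]
  exact (((hc.2 e χ hχ).inv).mul (tτ.mul (hf.2 e θ hθ))).mul tτ.inv

/-- The action of the variable `yⱼ`, that is, the bracket with `xⱼ` on the right. -/
def actVar (K : Type) [Field K] {n : ℕ} (j : Fin n) : Module.End K (FreeMetabelianLie K n) :=
  -LieAlgebra.ad K (FreeMetabelianLie K n) (xg K n j)

theorem actVar_apply (j : Fin n) (x : FreeMetabelianLie K n) :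
    actVar K j x = ⁅x, xg K n j⁆ := by
  simp [actVar, LieAlgebra.ad_apply]

/-- The element `[x_p, x_q] y_i^m y_r y_t^k`. -/
abbrev monoElt (K : Type) [Field K] {n : ℕ} (t : Fin n) (k : ℕ) (r i : Fin n) (m : ℕ)
    (p q : Fin n) : FreeMetabelianLie K n :=
  (actVar K t ^ k) (actVar K r ((actVar K i ^ m) ⁅xg K n p, xg K n q⁆))

theorem actVar_pow_mem {S : Submodule K (FreeMetabelianLie K n)} {j : Fin n}
    (hS : ∀ x ∈ S, ⁅x, xg K n j⁆ ∈ S) (k : ℕ) {x : FreeMetabelianLie K n} (hx : x ∈ S) :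
    (actVar K j ^ k) x ∈ S := by
  induction k with
  | zero => exact hx
  | succ k ih =>
    rw [pow_succ', Module.End.mul_apply, actVar_apply]
    exact hS _ ih

theorem actVar_pow_mem_derived (j : Fin n) (k : ℕ) {x : FreeMetabelianLie K n}
    (hx : x ∈ derived K n) : (actVar K j ^ k) x ∈ derived K n :=
  actVar_pow_mem (S := (derived K n).toSubmodule) (fun _ _ => lie_mem_derived _ _) k hx

theorem actVar_pow_mem_fixedSub {i : Fin n} (j : Fin n) (k : ℕ) {x : FreeMetabelianLie K n}
    (hx : x ∈ fixedSub K n i) : (actVar K j ^ k) x ∈ fixedSub K n i :=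
  actVar_pow_mem (fun _ hx => lie_xg_mem_fixedSub hx j) k hx

theorem actVar_pow_mem_others {i j : Fin n} (hj : j ≠ i) (k : ℕ) {x : FreeMetabelianLie K n}
    (hx : x ∈ others K n i) : (actVar K j ^ k) x ∈ others K n i :=
  actVar_pow_mem (S := (others K n i).toSubmodule)
    (fun _ hx => (others K n i).lie_mem hx (xg_mem_others hj)) k hx

theorem actVar_comm (a b : Fin n) {x : FreeMetabelianLie K n} (hx : x ∈ derived K n) :
    actVar K a (actVar K b x) = actVar K b (actVar K a x) := by
  simp only [actVar_apply]
  exact lie_lie_comm hx _ _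

theorem actVar_pow_comm (a b : Fin n) (k : ℕ) {x : FreeMetabelianLie K n}
    (hx : x ∈ derived K n) :
    actVar K a ((actVar K b ^ k) x) = (actVar K b ^ k) (actVar K a x) := by
  induction k with
  | zero => rfl
  | succ k ih =>
    rw [pow_succ', Module.End.mul_apply, Module.End.mul_apply,
      actVar_comm a b (actVar_pow_mem_derived b k hx), ih]

theorem map_actVar_pow {α : FreeMetabelianLie K n →ₗ⁅K⁆ FreeMetabelianLie K n} {j : Fin n}
    (hα : α (xg K n j) = xg K n j) (k : ℕ) (x : FreeMetabelianLie K n) :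
    α ((actVar K j ^ k) x) = (actVar K j ^ k) (α x) := by
  induction k with
  | zero => rfl
  | succ k ih =>
    rw [pow_succ', Module.End.mul_apply, Module.End.mul_apply, actVar_apply, actVar_apply,
      LieHom.map_lie, hα, ih]

theorem IsShift.map_actVar_pow {l : Fin n} {d : FreeMetabelianLie K n}
    {α : FreeMetabelianLie K n →ₗ⁅K⁆ FreeMetabelianLie K n} (hα : IsShift l d α)
    (hd : d ∈ derived K n) (j : Fin n) (k : ℕ) {x : FreeMetabelianLie K n}
    (hx : x ∈ derived K n) : α ((actVar K j ^ k) x) = (actVar K j ^ k) (α x) := by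
  by_cases hj : j = l
  · subst hj
    induction k with
    | zero => rfl
    | succ k ih =>
      have h : ⁅α ((actVar K j ^ k) x), d⁆ = 0 :=
        lie_eq_zero (map_mem_derived α (actVar_pow_mem_derived j k hx)) hd
      rw [pow_succ', Module.End.mul_apply, Module.End.mul_apply, actVar_apply, actVar_apply,
        LieHom.map_lie, hα.apply_self, lie_add, h, add_zero, ih]
  · exact FreeMetabelianLie.map_actVar_pow (hα.apply_of_ne j hj) k x

theorem lie_xg_mem_others {i p q : Fin n} (hp : p ≠ i) (hq : q ≠ i) :
    ⁅xg K n p, xg K n q⁆ ∈ others K n i :=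
  (others K n i).lie_mem (xg_mem_others hp) (xg_mem_others hq)

theorem lie_xg_mem_fixedSub_of_ne {i p q : Fin n} (hp : p ≠ i) (hq : q ≠ i) :
    ⁅xg K n p, xg K n q⁆ ∈ fixedSub K n i :=
  mem_fixedSub_of_mem_others (lie_mem_derived _ _) (lie_xg_mem_others hp hq)

theorem monoElt_mem_fixedSub (t : Fin n) (k : ℕ) (r i : Fin n) (m : ℕ) {p q e : Fin n}
    (hp : p ≠ e) (hq : q ≠ e) : monoElt K t k r i m p q ∈ fixedSub K n e := by
  have h := actVar_pow_mem_fixedSub i m (lie_xg_mem_fixedSub_of_ne (K := K) hp hq)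
  refine actVar_pow_mem_fixedSub t k ?_
  rw [actVar_apply]
  exact lie_xg_mem_fixedSub h r

theorem monoElt_mem_tameSub_of_aux {i l p q r t : Fin n} {k m : ℕ} (hil : i ≠ l) (hti : t ≠ i)
    (hri : r ≠ i) (hrl : r ≠ l) (hpi : p ≠ i) (hpl : p ≠ l) (hqi : q ≠ i) (hql : q ≠ l) :
    monoElt K t k r i m p q ∈ tameSub K n i := by
  have hd : ⁅xg K n l, xg K n r⁆ ∈ derived K n := lie_mem_derived _ _
  have hgd : (actVar K i ^ m) ⁅xg K n p, xg K n q⁆ ∈ derived K n :=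
    actVar_pow_mem_derived i m (lie_mem_derived _ _)
  refine mem_tameSub_of_commutator (l := l) (f := (actVar K t ^ k) ⁅xg K n l, xg K n r⁆)
    (g := (actVar K i ^ m) ⁅xg K n p, xg K n q⁆) hil ?_ ?_ ?_ ?_ ?_
  · exact mem_tameSub_of_mem_others (actVar_pow_mem_derived t k hd)
      (actVar_pow_mem_others hti k (lie_xg_mem_others hil.symm hri))
  · exact mem_tameSub_of_mem_others hgd
      (actVar_pow_mem_others hil m (lie_xg_mem_others hpl hql))
  · exact actVar_pow_mem_fixedSub i m (lie_xg_mem_fixedSub_of_ne hpi hqi)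
  · exact monoElt_mem_fixedSub t k r i m hpi hqi
  · intro c β hβ
    have h := IsShift.map_actVar_pow hβ ((derived K n).smul_mem c hgd) t k hd
    rw [LieHom.map_lie, hβ.apply_self, hβ.apply_of_ne r hrl, add_lie, smul_lie,
      ← actVar_apply r ((actVar K i ^ m) _), map_add, map_smul] at h
    exact h

theorem polarized_mem_tameSub {i p q r : Fin n} {k m : ℕ} (hip : i ≠ p) (hiq : i ≠ q)
    (hir : i ≠ r) (hpq : p ≠ q) (hpr : p ≠ r) (hqr : q ≠ r) :
    monoElt K r k r i m p q + monoElt K r k p i m r q ∈ tameSub K n i := by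
  obtain ⟨τ, hτ, tτ⟩ := exists_transvection (K := K) (p := p) (r := r) hpr.symm 1
  have h₁ : monoElt K r k p i m p q ∈ tameSub K n i :=
    monoElt_mem_tameSub_of_aux (l := r) hir hir.symm hip.symm hpr hip.symm hpr hiq.symm hqr
  have h₂ : monoElt K r k r i m r q ∈ tameSub K n i :=
    monoElt_mem_tameSub_of_aux (l := p) hip hir.symm hir.symm hpr.symm hir.symm hpr.symm
      hiq.symm hpq.symm
  have h₃ := transvection_mem_tameSub hip hir.symm hτ tτ h₁
  have e : τ (monoElt K r k p i m p q) = monoElt K r k p i m p q + monoElt K r k r i m p q +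
      (monoElt K r k p i m r q + monoElt K r k r i m r q) := by
    have e₁ := map_actVar_pow (hτ.apply_of_ne r hpr.symm) k
      (actVar K p ((actVar K i ^ m) ⁅xg K n p, xg K n q⁆))
    have e₂ := map_actVar_pow (hτ.apply_of_ne i hip) m ⁅xg K n p, xg K n q⁆
    have e₃ : (τ : FreeMetabelianLie K n →ₗ⁅K⁆ FreeMetabelianLie K n)
        (actVar K p ((actVar K i ^ m) ⁅xg K n p, xg K n q⁆)) =
        ⁅(actVar K i ^ m) ⁅xg K n p + xg K n r, xg K n q⁆, xg K n p + xg K n r⁆ := by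
      rw [actVar_apply, LieHom.map_lie, e₂, LieHom.map_lie, hτ.apply_self,
        hτ.apply_of_ne q hpq.symm, one_smul]
    rw [e₃] at e₁
    refine e₁.trans ?_
    simp only [monoElt, actVar_apply, add_lie, lie_add, map_add]
    abel
  rw [e] at h₃
  have h₄ := sub_mem (sub_mem h₃ h₁) h₂
  convert h₄ using 1
  abel

theorem monoElt_jacobi (r i : Fin n) (k m : ℕ) (p q : Fin n) :
    monoElt K r k r i m p q + monoElt K r k p i m q r + monoElt K r k q i m r p = 0 := by
  have h : ∀ a b c : Fin n, monoElt K r k a i m b c =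
      (actVar K r ^ k) ((actVar K i ^ m) ⁅⁅xg K n b, xg K n c⁆, xg K n a⁆) := fun a b c => by
    rw [monoElt, actVar_pow_comm a i m (lie_mem_derived _ _), actVar_apply]
  have hJ : ⁅⁅xg K n p, xg K n q⁆, xg K n r⁆ + ⁅⁅xg K n q, xg K n r⁆, xg K n p⁆ +
      ⁅⁅xg K n r, xg K n p⁆, xg K n q⁆ = 0 := by
    rw [← lie_skew ⁅xg K n p, xg K n q⁆, ← lie_skew ⁅xg K n q, xg K n r⁆,
      ← lie_skew ⁅xg K n r, xg K n p⁆, ← neg_add, ← neg_add, neg_eq_zero,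
      ← lie_jacobi (xg K n p) (xg K n q) (xg K n r)]
    abel
  rw [h, h, h, ← map_add, ← map_add, ← map_add, ← map_add, hJ, map_zero, map_zero]

theorem monoElt_skew (t : Fin n) (k : ℕ) (r i : Fin n) (m : ℕ) (p q : Fin n) :
    monoElt K t k r i m q p = -monoElt K t k r i m p q := by
  rw [monoElt, ← lie_skew, map_neg, map_neg, map_neg]

theorem monoElt_mem_tameSub (hK : (4 ≤ n ∧ ringChar K ≠ 3) ∨ 5 ≤ n) {i p q r : Fin n}
    (k m : ℕ) (hip : i ≠ p) (hiq : i ≠ q) (hir : i ≠ r) (hpq : p ≠ q) (hpr : p ≠ r)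
    (hqr : q ≠ r) : monoElt K r k r i m p q ∈ tameSub K n i := by
  rcases hK with ⟨-, hK⟩ | hn
  · have h3 : (3 : K) ≠ 0 := fun h => by
      have h' : ringChar K ∣ 3 := ringChar.dvd (by exact_mod_cast h)
      rcases (Nat.dvd_prime Nat.prime_three).1 h' with h₁ | h₁
      · exact CharP.ringChar_ne_one h₁
      · exact hK h₁
    have h₁ := polarized_mem_tameSub (K := K) (k := k) (m := m) hip hiq hir hpq hpr hqr
    have h₂ := polarized_mem_tameSub (K := K) (k := k) (m := m) hiq hip hir hpq.symm hqr hpr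
    have hJ := monoElt_jacobi (K := K) r i k m p q
    have e : (3 : K) • monoElt K r k r i m p q =
        (monoElt K r k r i m p q + monoElt K r k p i m r q) -
        (monoElt K r k r i m q p + monoElt K r k q i m r p) := by
      rw [monoElt_skew r k r i m p q, monoElt_skew r k p i m q r] at *
      rw [← sub_eq_zero, ← hJ]
      module
    have h := (tameSub K n i).smul_mem (3 : K)⁻¹ (e ▸ sub_mem h₁ h₂)
    rwa [inv_smul_smul₀ h3] at h
  · obtain ⟨l, hl⟩ : ∃ l, l ∉ ({i, p, q, r} : Finset (Fin n)) := by
      by_contra! h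
      have h₁ : Finset.univ.card ≤ ({i, p, q, r} : Finset (Fin n)).card :=
        Finset.card_le_card fun x _ => h x
      have h₂ : ({i, p, q, r} : Finset (Fin n)).card ≤ 4 := Finset.card_le_four
      rw [Finset.card_univ, Fintype.card_fin] at h₁
      omega
    simp only [Finset.mem_insert, Finset.mem_singleton, not_or] at hl
    obtain ⟨h₁, h₂, h₃, h₄⟩ := hl
    exact monoElt_mem_tameSub_of_aux (l := l) (Ne.symm h₁) hir.symm hir.symm (Ne.symm h₄)
      hip.symm (Ne.symm h₂) hiq.symm (Ne.symm h₃)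

theorem actVar_pow_lie_mem_tameSub (hK : (4 ≤ n ∧ ringChar K ≠ 3) ∨ 5 ≤ n) {i a b : Fin n}
    (hia : i ≠ a) (hib : i ≠ b) (hab : a ≠ b) {s : ℕ} (hs : 2 ≤ s) :
    (actVar K i ^ s) ⁅xg K n a, xg K n b⁆ ∈ tameSub K n i := by
  obtain ⟨s, rfl⟩ := Nat.exists_eq_add_of_le' hs
  obtain ⟨c, hc⟩ : ∃ c, c ∉ ({i, a, b} : Finset (Fin n)) := by
    by_contra! h
    have h₁ : Finset.univ.card ≤ ({i, a, b} : Finset (Fin n)).card :=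
      Finset.card_le_card fun x _ => h x
    have h₂ : ({i, a, b} : Finset (Fin n)).card ≤ 3 := Finset.card_le_three
    rw [Finset.card_univ, Fintype.card_fin] at h₁
    omega
  simp only [Finset.mem_insert, Finset.mem_singleton, not_or] at hc
  obtain ⟨hci, hca, hcb⟩ := hc
  have hd : ⁅xg K n a, xg K n b⁆ ∈ derived K n := lie_mem_derived _ _
  have hf : actVar K c ((actVar K i ^ (s + 1)) ⁅xg K n a, xg K n b⁆) ∈ tameSub K n i :=
    monoElt_mem_tameSub hK 0 (s + 1) hia hib (Ne.symm hci) hab (Ne.symm hca) (Ne.symm hcb)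
  have hfc : actVar K c ((actVar K i ^ (s + 1)) ⁅xg K n a, xg K n b⁆) ∈ tameSub K n c := by
    have h := monoElt_mem_tameSub hK s 1 hca hcb hci hab hia.symm hib.symm
    rwa [actVar_pow_comm c i (s + 1) hd, pow_succ, Module.End.mul_apply]
  have hgc : (actVar K i ^ (s + 2)) ⁅xg K n a, xg K n b⁆ ∈ tameSub K n c :=
    mem_tameSub_of_mem_others (actVar_pow_mem_derived i _ hd)
      (actVar_pow_mem_others (Ne.symm hci) _ (lie_xg_mem_others (Ne.symm hca) (Ne.symm hcb)))
  have hgi : (actVar K i ^ (s + 2)) ⁅xg K n a, xg K n b⁆ ∈ fixedSub K n i :=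
    actVar_pow_mem_fixedSub i _ (lie_xg_mem_fixedSub_of_ne hia.symm hib.symm)
  obtain ⟨τ, hτ, tτ⟩ := exists_transvection (K := K) (Ne.symm hci) (-1)
  have e : τ (actVar K c ((actVar K i ^ (s + 1)) ⁅xg K n a, xg K n b⁆)) =
      actVar K c ((actVar K i ^ (s + 1)) ⁅xg K n a, xg K n b⁆) -
      (actVar K i ^ (s + 2)) ⁅xg K n a, xg K n b⁆ := by
    have e₁ := map_actVar_pow (hτ.apply_of_ne i (Ne.symm hci)) (s + 1) ⁅xg K n a, xg K n b⁆
    have e₂ := (τ : FreeMetabelianLie K n →ₗ⁅K⁆ FreeMetabelianLie K n).map_lie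
      ((actVar K i ^ (s + 1)) ⁅xg K n a, xg K n b⁆) (xg K n c)
    have e₃ : (τ : FreeMetabelianLie K n →ₗ⁅K⁆ FreeMetabelianLie K n) ⁅xg K n a, xg K n b⁆ =
        ⁅xg K n a, xg K n b⁆ := by
      rw [LieHom.map_lie, hτ.apply_of_ne a (Ne.symm hca), hτ.apply_of_ne b (Ne.symm hcb)]
    rw [e₁, e₃, hτ.apply_self, neg_one_smul, ← sub_eq_add_neg, lie_sub] at e₂
    rw [pow_succ' _ (s + 1), Module.End.mul_apply, actVar_apply, actVar_apply]
    exact e₂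
  have h := transvection_mem_tameSub_of_mem (Ne.symm hci) hτ tτ hf
    (e ▸ sub_mem hfc hgc) (e ▸ sub_mem hf.1 hgi)
  rw [e] at h
  simpa using sub_mem hf h

theorem polyAct_X_pow (i : Fin n) (s : ℕ) (m : FreeMetabelianLie K n) (hi : (i : ℕ) = 0) :
    polyAct K n (MvPolynomial.X i ^ s) m = (actVar K i ^ s) m := by
  cases n with
  | zero => exact i.elim0
  | succ n =>
    obtain rfl : i = 0 := Fin.ext hi
    classical
    rw [polyAct, MvPolynomial.X_pow_eq_monomial, MvPolynomial.support_monomial,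
      if_neg one_ne_zero, Finset.sum_singleton, MvPolynomial.coeff_monomial, if_pos rfl, one_smul,
      List.ofFn_succ, List.prod_cons, List.prod_eq_one, mul_one, Finsupp.single_eq_same]
    · rfl
    · intro x hx
      obtain ⟨j, rfl⟩ := List.mem_ofFn.1 hx
      simp

end FreeMetabelianLie

end

open MvPolynomial in
/-- **Case 3 of Theorem 1.** Over a field `K`, with `n ≥ 4` and `char K ≠ 3`, or `n ≥ 5`,
for every `s ≥ 2`, the Chein automorphism `C(y₁ˢ) = (x₁ + [x₂,x₃]y₁ˢ, x₂, …, xₙ)` of `Mₙ`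
is tame. -/
theorem chein_y1_pow_is_tame (K : Type) [Field K] (n : ℕ) (hn : 0 < n)
    (hK : (4 ≤ n ∧ ringChar K ≠ 3) ∨ 5 ≤ n)
    (s : ℕ) (hs : 2 ≤ s)
    (i0 i1 i2 : Fin n) (h0 : (i0 : ℕ) = 0) (h1 : (i1 : ℕ) = 1) (h2 : (i2 : ℕ) = 2)
    (φ : FreeMetabelianLie K n ≃ₗ⁅K⁆ FreeMetabelianLie K n)
    (hφ0 : φ (xg K n i0) = xg K n i0 + polyAct K n (X i0 ^ s) ⁅xg K n i1, xg K n i2⁆)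
    (hφ : ∀ j : Fin n, j ≠ i0 → φ (xg K n j) = xg K n j) :
    IsTame K n φ := by
  have h01 : i0 ≠ i1 := fun h => by simp [h, h1] at h0
  have h02 : i0 ≠ i2 := fun h => by simp [h, h2] at h0
  have h12 : i1 ≠ i2 := fun h => by simp [h, h2] at h1
  rw [FreeMetabelianLie.polyAct_X_pow i0 s _ h0] at hφ0
  exact (FreeMetabelianLie.actVar_pow_lie_mem_tameSub hK h01 h02 h12 hs).2 1 φ
    ⟨by rw [one_smul]; exact hφ0, hφ⟩
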